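/- Let (P_t)_{t≥0} be a Feller, stochastically continuous Markov transition semigroup on a Polish metric space 𝒳 with the e-property, and suppose there exists z ∈ 𝒳 such that: (i) for every bounded set A ⊆ 𝒳 and every δ > 0, inf_{x∈A} liminf_{T→∞} Q^T(x, B(z,δ)) > 0; and (ii) for every ε > 0 and every x ∈ 𝒳 there exists a bounded Borel set D with liminf_{T→∞} Q^T(x,D) > 1 − ε. Then 𝒯 = 𝒳: for every x ∈ 𝒳 the family of measures (Q^T(x,·))_{T>0} is tight. -/

import Mathlib

open MeasureTheory Filter Topology Metric Set

noncomputable section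

/-- A Markov transition semigroup on a measurable space `X`: a jointly measurable family
of Markov probability kernels `P t x` with `P 0 x = δ_x` and the Chapman–Kolmogorov
semigroup property for nonnegative times. -/
structure MarkovSemigroup (X : Type*) [MeasurableSpace X] where
  P : ℝ → X → MeasureTheory.Measure X
  prob : ∀ t x, MeasureTheory.IsProbabilityMeasure (P t x)
  meas : Measurable fun p : ℝ × X => P p.1 p.2
  init : ∀ x : X, P 0 x = MeasureTheory.Measure.dirac x
  semigroup : ∀ t s : ℝ, 0 ≤ t → 0 ≤ s → ∀ x : X,
    P (t + s) x = (P t x).bind (P s)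

namespace MarkovSemigroup

variable {X : Type*} [MeasurableSpace X]

/-- Action `P_t f(x) = ∫ f(y) P_t(x,dy)` on functions. -/
def act (M : MarkovSemigroup X) (t : ℝ) (f : X → ℝ) (x : X) : ℝ :=
  ∫ y, f y ∂(M.P t x)

/-- Dual action `P_t^* μ` on measures. -/
def dual (M : MarkovSemigroup X) (t : ℝ) (μ : MeasureTheory.Measure X) :
    MeasureTheory.Measure X :=
  μ.bind (M.P t)

/-- The time average `Q^T μ = (1/T) ∫_0^T P_s^* μ ds` (with the convention
`Q^T μ = μ` for `T ≤ 0`). -/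
def QM (M : MarkovSemigroup X) (T : ℝ) (μ : MeasureTheory.Measure X) :
    MeasureTheory.Measure X :=
  if T ≤ 0 then μ
  else ((ENNReal.ofReal (1 / T)) • (volume.restrict (Set.Ioc (0 : ℝ) T))).bind
    fun s => M.dual s μ

/-- `Q^T(x,·) := Q^T δ_x`. -/
def Q (M : MarkovSemigroup X) (T : ℝ) (x : X) : MeasureTheory.Measure X :=
  M.QM T (MeasureTheory.Measure.dirac x)

/-- Iterated averages: for `ts = [t_k, …, t_1]`, `QMs ts μ = Q^{t_k}(⋯(Q^{t_1} μ)⋯)`. -/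
def QMs (M : MarkovSemigroup X) (ts : List ℝ) (μ : MeasureTheory.Measure X) :
    MeasureTheory.Measure X :=
  ts.foldr (fun t ν => M.QM t ν) μ

/-- A measure is invariant if `P_t^* μ = μ` for all `t ≥ 0`. -/
def Invariant (M : MarkovSemigroup X) (μ : MeasureTheory.Measure X) : Prop :=
  ∀ t : ℝ, 0 ≤ t → M.dual t μ = μ

section TopologicalDefs

variable [TopologicalSpace X]

/-- Bounded continuous real functions. -/
def IsBddContinuous (f : X → ℝ) : Prop :=
  Continuous f ∧ ∃ C : ℝ, ∀ x, |f x| ≤ C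

/-- The Feller property: `P_t` maps bounded continuous functions to continuous ones. -/
def Feller (M : MarkovSemigroup X) : Prop :=
  ∀ t : ℝ, 0 ≤ t → ∀ f : X → ℝ, MarkovSemigroup.IsBddContinuous f →
    Continuous (M.act t f)

/-- Stochastic continuity: `P_t f(x) → f(x)` as `t → 0+`. -/
def StochasticallyContinuous (M : MarkovSemigroup X) : Prop :=
  ∀ f : X → ℝ, MarkovSemigroup.IsBddContinuous f → ∀ x : X,
    Filter.Tendsto (fun t : ℝ => M.act t f x) (nhdsWithin 0 (Set.Ioi 0)) (nhds (f x))

/-- Weak convergence of `Q^T ν` to `μ` as `T → ∞`. -/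
def QTendsto (M : MarkovSemigroup X) (ν μ : MeasureTheory.Measure X) : Prop :=
  ∀ f : X → ℝ, MarkovSemigroup.IsBddContinuous f →
    Filter.Tendsto (fun T : ℝ => ∫ x, f x ∂(M.QM T ν)) Filter.atTop
      (nhds (∫ x, f x ∂μ))

/-- Weak-* mean ergodicity with limit `μstar`. -/
def WeakStarMeanErgodic (M : MarkovSemigroup X) (μstar : MeasureTheory.Measure X) : Prop :=
  ∀ ν : MeasureTheory.Measure X, MeasureTheory.IsProbabilityMeasure ν → M.QTendsto ν μstar

/-- Tightness of the family `(Q^T(x,·))_{T>0}`. -/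
def TightAt (M : MarkovSemigroup X) (x : X) : Prop :=
  ∀ ε : ℝ, 0 < ε → ∃ K : Set X, IsCompact K ∧
    ∀ T : ℝ, 0 < T → 1 - ε ≤ ((M.Q T x) K).toReal

end TopologicalDefs

end MarkovSemigroup

/-- Topological support of a measure: points all of whose open neighborhoods
have positive mass. -/
def msupport {X : Type*} [MeasurableSpace X] [TopologicalSpace X]
    (μ : MeasureTheory.Measure X) : Set X :=
  {x : X | ∀ U : Set X, IsOpen U → x ∈ U → 0 < μ U}

/-- Total variation distance between two (finite) measures, as the supremum over
Borel sets of the discrepancy of masses. -/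
def tvDist {X : Type*} [MeasurableSpace X] (μ ν : MeasureTheory.Measure X) : ℝ :=
  ⨆ B : {B : Set X // MeasurableSet B}, |(μ B.1).toReal - (ν B.1).toReal|

section MetricDefs

variable {X : Type*} [MeasurableSpace X] [PseudoMetricSpace X]

/-- Bounded Lipschitz real functions. -/
def IsBddLipschitz (ψ : X → ℝ) : Prop :=
  (∃ K : NNReal, LipschitzWith K ψ) ∧ ∃ C : ℝ, ∀ x, |ψ x| ≤ C

/-- The e-property: equicontinuity of `(P_t ψ)_{t ≥ 0}` at every point, for every
bounded Lipschitz `ψ`. -/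
def MarkovSemigroup.EProperty (M : MarkovSemigroup X) : Prop :=
  ∀ ψ : X → ℝ, IsBddLipschitz ψ → ∀ x : X, ∀ ε : ℝ, 0 < ε →
    ∃ δ : ℝ, 0 < δ ∧ ∀ z : X, dist z x < δ → ∀ t : ℝ, 0 ≤ t →
      |M.act t ψ z - M.act t ψ x| < ε

end MetricDefs

namespace MarkovSemigroup

section Averages

variable {X : Type*} [MeasurableSpace X] (M : MarkovSemigroup X)

instance isProbabilityMeasure_P (t : ℝ) (x : X) : IsProbabilityMeasure (M.P t x) := M.prob t x

lemma measurable_P (t : ℝ) : Measurable (M.P t) := M.meas.comp measurable_prodMk_left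

lemma measurable_lintegral_P {F : X → ENNReal} (hF : Measurable F) :
    Measurable fun p : ℝ × X => ∫⁻ w, F w ∂M.P p.1 p.2 :=
  (Measure.measurable_lintegral hF).comp M.meas

lemma lintegral_dual (t : ℝ) (μ : Measure X) {F : X → ENNReal} (hF : Measurable F) :
    ∫⁻ w, F w ∂M.dual t μ = ∫⁻ y, ∫⁻ w, F w ∂M.P t y ∂μ :=
  Measure.lintegral_bind (M.measurable_P t).aemeasurable hF.aemeasurable

lemma dual_univ (t : ℝ) (μ : Measure X) : M.dual t μ univ = μ univ := by
  rw [dual, Measure.bind_apply MeasurableSet.univ (M.measurable_P t).aemeasurable]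
  simp

lemma dual_dirac (t : ℝ) (x : X) : M.dual t (Measure.dirac x) = M.P t x :=
  Measure.dirac_bind (M.measurable_P t) x

lemma measurable_dual (μ : Measure X) [SFinite μ] : Measurable fun s => M.dual s μ := by
  refine Measure.measurable_of_measurable_coe _ fun s hs => ?_
  simp_rw [dual, Measure.bind_apply hs (M.measurable_P _).aemeasurable]
  exact ((Measure.measurable_coe hs).comp M.meas).lintegral_prod_right'

lemma dual_dual {s t : ℝ} (hs : 0 ≤ s) (ht : 0 ≤ t) (μ : Measure X) :
    M.dual s (M.dual t μ) = M.dual (t + s) μ := by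
  rw [dual, dual, dual, Measure.bind_bind (M.measurable_P t).aemeasurable
    (M.measurable_P s).aemeasurable]
  congr 1
  ext1 x
  exact (M.semigroup t s ht hs x).symm

/-- The uniform distribution on `(0, T]`. -/
def timeAvg (T : ℝ) : Measure ℝ := ENNReal.ofReal (1 / T) • volume.restrict (Ioc (0 : ℝ) T)

lemma isProbabilityMeasure_timeAvg {T : ℝ} (hT : 0 < T) : IsProbabilityMeasure (timeAvg T) := by
  constructor
  rw [timeAvg, Measure.smul_apply, Measure.restrict_apply_univ, Real.volume_Ioc, smul_eq_mul,
    ← ENNReal.ofReal_mul (by positivity)]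
  simp [hT.ne']

lemma ae_timeAvg_pos (T : ℝ) : ∀ᵐ s ∂timeAvg T, s ∈ Ioc 0 T :=
  Measure.ae_smul_measure (ae_restrict_mem measurableSet_Ioc) _

lemma QM_eq_bind {T : ℝ} (hT : 0 < T) (μ : Measure X) :
    M.QM T μ = (timeAvg T).bind fun s => M.dual s μ := by
  rw [QM, if_neg hT.not_ge, timeAvg]

lemma lintegral_QM {T : ℝ} (hT : 0 < T) (μ : Measure X) [SFinite μ] {F : X → ENNReal}
    (hF : Measurable F) :
    ∫⁻ w, F w ∂M.QM T μ = ∫⁻ s, ∫⁻ w, F w ∂M.dual s μ ∂timeAvg T := by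
  rw [M.QM_eq_bind hT, Measure.lintegral_bind (M.measurable_dual μ).aemeasurable hF.aemeasurable]

lemma lintegral_Q {T : ℝ} (hT : 0 < T) (x : X) {F : X → ENNReal} (hF : Measurable F) :
    ∫⁻ w, F w ∂M.Q T x = ∫⁻ s, ∫⁻ w, F w ∂M.P s x ∂timeAvg T := by
  rw [Q, M.lintegral_QM hT _ hF]
  simp_rw [dual_dirac]

lemma Q_apply {T : ℝ} (hT : 0 < T) (x : X) {E : Set X} (hE : MeasurableSet E) :
    M.Q T x E = ∫⁻ s, M.P s x E ∂timeAvg T := by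
  have := M.lintegral_Q hT x (measurable_one.indicator hE)
  simpa [lintegral_indicator_one hE] using this

lemma isProbabilityMeasure_Q {T : ℝ} (hT : 0 < T) (x : X) : IsProbabilityMeasure (M.Q T x) := by
  have := isProbabilityMeasure_timeAvg hT
  constructor
  rw [M.Q_apply hT x MeasurableSet.univ]
  simp

instance sFinite_timeAvg (T : ℝ) : SFinite (timeAvg T) := by
  unfold timeAvg; infer_instance

lemma measurable_lintegral_Q {T : ℝ} (hT : 0 < T) {F : X → ENNReal} (hF : Measurable F) :
    Measurable fun x => ∫⁻ w, F w ∂M.Q T x := by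
  simp_rw [M.lintegral_Q hT _ hF]
  exact (M.measurable_lintegral_P hF).lintegral_prod_left'

lemma lintegral_QM_eq_lintegral_Q {T : ℝ} (hT : 0 < T) (μ : Measure X) [SFinite μ]
    {F : X → ENNReal} (hF : Measurable F) :
    ∫⁻ w, F w ∂M.QM T μ = ∫⁻ x, ∫⁻ w, F w ∂M.Q T x ∂μ := by
  simp_rw [M.lintegral_QM hT μ hF, M.lintegral_Q hT _ hF, M.lintegral_dual _ _ hF]
  exact lintegral_lintegral_swap (M.measurable_lintegral_P hF).aemeasurable

lemma QM_apply_eq_lintegral_Q {T : ℝ} (hT : 0 < T) (μ : Measure X) [SFinite μ]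
    {E : Set X} (hE : MeasurableSet E) : M.QM T μ E = ∫⁻ x, M.Q T x E ∂μ := by
  have := M.lintegral_QM_eq_lintegral_Q hT μ (measurable_one.indicator hE)
  simpa [lintegral_indicator_one hE] using this

lemma QM_apply {T : ℝ} (hT : 0 < T) (μ : Measure X) [SFinite μ]
    {E : Set X} (hE : MeasurableSet E) : M.QM T μ E = ∫⁻ s, M.dual s μ E ∂timeAvg T := by
  have := M.lintegral_QM hT μ (measurable_one.indicator hE)
  simpa [lintegral_indicator_one hE] using this

lemma exists_dual_le_QM {T : ℝ} (hT : 0 < T) (μ : Measure X) [IsFiniteMeasure μ]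
    {E : Set X} (hE : MeasurableSet E) : ∃ s, 0 ≤ s ∧ M.dual s μ E ≤ M.QM T μ E := by
  have := isProbabilityMeasure_timeAvg hT
  have hm : Measurable fun s => M.dual s μ E :=
    (Measure.measurable_coe hE).comp (M.measurable_dual μ)
  rw [M.QM_apply hT μ hE]
  obtain ⟨s, hs, h⟩ := exists_notMem_null_le_lintegral hm.aemeasurable
    (ae_iff.1 (ae_timeAvg_pos T))
  exact ⟨s, (not_not.1 hs).1.le, h⟩

lemma exists_QM_le_dual {T : ℝ} (hT : 0 < T) (μ : Measure X) [IsFiniteMeasure μ]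
    {E : Set X} (hE : MeasurableSet E) : ∃ s, 0 ≤ s ∧ M.QM T μ E ≤ M.dual s μ E := by
  have := isProbabilityMeasure_timeAvg hT
  rw [M.QM_apply hT μ hE]
  obtain ⟨s, hs, h⟩ := exists_notMem_null_lintegral_le (μ := timeAvg T)
    (f := fun s => M.dual s μ E) (ne_of_lt <| calc
      ∫⁻ s, M.dual s μ E ∂timeAvg T ≤ ∫⁻ _, μ univ ∂timeAvg T :=
        lintegral_mono fun s => (measure_mono (subset_univ _)).trans (M.dual_univ s μ).le
      _ < ⊤ := by simp)
    (ae_iff.1 (ae_timeAvg_pos T))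
  exact ⟨s, (not_not.1 hs).1.le, h⟩

lemma lintegral_timeAvg (T : ℝ) (a : ℝ → ENNReal) :
    ∫⁻ r, a r ∂timeAvg T = ENNReal.ofReal (1 / T) * ∫⁻ r in Ioc 0 T, a r := by
  rw [timeAvg, lintegral_smul_measure, smul_eq_mul]

lemma setLIntegral_Ioc_add_right (a : ℝ → ENNReal) (s u v : ℝ) :
    ∫⁻ r in Ioc u v, a (r + s) = ∫⁻ r in Ioc (u + s) (v + s), a r := by
  have h := (measurePreserving_add_right volume s).setLIntegral_comp_preimage_emb
    (MeasurableEquiv.addRight s).measurableEmbedding a (Ioc (u + s) (v + s))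
  simpa using h

lemma setLIntegral_Ioc_le {a : ℝ → ENNReal} (ha : ∀ r, a r ≤ 1) (u v : ℝ) :
    ∫⁻ r in Ioc u v, a r ≤ ENNReal.ofReal (v - u) := by
  calc ∫⁻ r in Ioc u v, a r ≤ ∫⁻ _ in Ioc u v, 1 := lintegral_mono ha
    _ = ENNReal.ofReal (v - u) := by simp

lemma lintegral_timeAvg_add_le {a : ℝ → ENNReal} (ha : ∀ r, a r ≤ 1) {s T : ℝ} (hs : 0 ≤ s)
    (hT : 0 < T) :
    ∫⁻ r, a (r + s) ∂timeAvg T ≤ ∫⁻ r, a r ∂timeAvg T + ENNReal.ofReal (s / T) := by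
  have e : ENNReal.ofReal (s / T) = ENNReal.ofReal (1 / T) * ENNReal.ofReal s := by
    rw [← ENNReal.ofReal_mul (by positivity)]; congr 1; ring
  rw [lintegral_timeAvg, lintegral_timeAvg, e, ← mul_add]
  gcongr
  rw [setLIntegral_Ioc_add_right]
  calc ∫⁻ r in Ioc (0 + s) (T + s), a r ≤ ∫⁻ r in Ioc 0 T ∪ Ioc T (T + s), a r :=
        lintegral_mono_set fun r hr => by
          rcases le_or_gt r T with h | h
          · exact .inl ⟨by linarith [hr.1], h⟩
          · exact .inr ⟨h, hr.2⟩
    _ ≤ (∫⁻ r in Ioc 0 T, a r) + ∫⁻ r in Ioc T (T + s), a r := lintegral_union_le _ _ _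
    _ ≤ _ := by
      gcongr
      simpa using setLIntegral_Ioc_le ha T (T + s)

lemma lintegral_timeAvg_le_add {a : ℝ → ENNReal} (ha : ∀ r, a r ≤ 1) {s T : ℝ} (hs : 0 ≤ s)
    (hT : 0 < T) :
    ∫⁻ r, a r ∂timeAvg T ≤ ∫⁻ r, a (r + s) ∂timeAvg T + ENNReal.ofReal (s / T) := by
  have e : ENNReal.ofReal (s / T) = ENNReal.ofReal (1 / T) * ENNReal.ofReal s := by
    rw [← ENNReal.ofReal_mul (by positivity)]; congr 1; ring
  rw [lintegral_timeAvg, lintegral_timeAvg, e, ← mul_add]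
  gcongr
  rw [setLIntegral_Ioc_add_right]
  calc ∫⁻ r in Ioc 0 T, a r ≤ ∫⁻ r in Ioc (0 + s) (T + s) ∪ Ioc 0 s, a r :=
        lintegral_mono_set fun r hr => by
          rcases le_or_gt r s with h | h
          · exact .inr ⟨hr.1, h⟩
          · exact .inl ⟨by linarith, by linarith [hr.2]⟩
    _ ≤ (∫⁻ r in Ioc (0 + s) (T + s), a r) + ∫⁻ r in Ioc 0 s, a r := lintegral_union_le _ _ _
    _ ≤ _ := by
      gcongr
      simpa using setLIntegral_Ioc_le ha 0 s

lemma lintegral_dual_le_one (t : ℝ) {μ : Measure X} (hμ : μ univ ≤ 1) {F : X → ENNReal}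
    (hF1 : ∀ w, F w ≤ 1) : ∫⁻ w, F w ∂M.dual t μ ≤ 1 :=
  calc ∫⁻ w, F w ∂M.dual t μ ≤ ∫⁻ _, 1 ∂M.dual t μ := lintegral_mono hF1
    _ ≤ 1 := by simpa [M.dual_univ] using hμ

lemma lintegral_QM_dual {s T : ℝ} (hs : 0 ≤ s) (hT : 0 < T) {μ : Measure X} [IsFiniteMeasure μ]
    {F : X → ENNReal} (hF : Measurable F) :
    ∫⁻ w, F w ∂M.QM T (M.dual s μ) = ∫⁻ r, ∫⁻ w, F w ∂M.dual (r + s) μ ∂timeAvg T := by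
  have : IsFiniteMeasure (M.dual s μ) := ⟨by rw [M.dual_univ]; exact measure_lt_top _ _⟩
  rw [M.lintegral_QM hT _ hF]
  refine lintegral_congr_ae ?_
  filter_upwards [ae_timeAvg_pos T] with r hr
  rw [M.dual_dual hr.1.le hs, add_comm]

lemma lintegral_dual_QM {s T : ℝ} (hs : 0 ≤ s) (hT : 0 < T) {μ : Measure X} [IsFiniteMeasure μ]
    {F : X → ENNReal} (hF : Measurable F) :
    ∫⁻ w, F w ∂M.dual s (M.QM T μ) = ∫⁻ r, ∫⁻ w, F w ∂M.dual (r + s) μ ∂timeAvg T := by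
  have hm : Measurable fun y => ∫⁻ w, F w ∂M.P s y :=
    (M.measurable_lintegral_P hF).comp measurable_prodMk_left
  rw [M.lintegral_dual _ _ hF, M.lintegral_QM hT _ hm]
  refine lintegral_congr_ae ?_
  filter_upwards [ae_timeAvg_pos T] with r hr
  rw [← M.lintegral_dual _ _ hF, M.dual_dual hs hr.1.le]

lemma lintegral_QM_dual_le {s T : ℝ} (hs : 0 ≤ s) (hT : 0 < T) {μ : Measure X} [IsFiniteMeasure μ]
    (hμ : μ univ ≤ 1) {F : X → ENNReal} (hF : Measurable F) (hF1 : ∀ w, F w ≤ 1) :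
    ∫⁻ w, F w ∂M.QM T (M.dual s μ) ≤ ∫⁻ w, F w ∂M.QM T μ + ENNReal.ofReal (s / T) := by
  rw [M.lintegral_QM_dual hs hT hF, M.lintegral_QM hT _ hF]
  exact lintegral_timeAvg_add_le (fun r => M.lintegral_dual_le_one r hμ hF1) hs hT

lemma lintegral_QM_le_dual {s T : ℝ} (hs : 0 ≤ s) (hT : 0 < T) {μ : Measure X} [IsFiniteMeasure μ]
    (hμ : μ univ ≤ 1) {F : X → ENNReal} (hF : Measurable F) (hF1 : ∀ w, F w ≤ 1) :
    ∫⁻ w, F w ∂M.QM T μ ≤ ∫⁻ w, F w ∂M.QM T (M.dual s μ) + ENNReal.ofReal (s / T) := by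
  rw [M.lintegral_QM_dual hs hT hF, M.lintegral_QM hT _ hF]
  exact lintegral_timeAvg_le_add (fun r => M.lintegral_dual_le_one r hμ hF1) hs hT

lemma QM_dual_apply_le {s T : ℝ} (hs : 0 ≤ s) (hT : 0 < T) {μ : Measure X} [IsFiniteMeasure μ]
    (hμ : μ univ ≤ 1) {E : Set X} (hE : MeasurableSet E) :
    M.QM T (M.dual s μ) E ≤ M.QM T μ E + ENNReal.ofReal (s / T) := by
  have := M.lintegral_QM_dual_le hs hT hμ (measurable_one.indicator hE)
    fun w => indicator_le_self' (fun _ _ => zero_le) w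
  simpa [lintegral_indicator_one hE] using this

lemma QM_apply_le_dual {s T : ℝ} (hs : 0 ≤ s) (hT : 0 < T) {μ : Measure X} [IsFiniteMeasure μ]
    (hμ : μ univ ≤ 1) {E : Set X} (hE : MeasurableSet E) :
    M.QM T μ E ≤ M.QM T (M.dual s μ) E + ENNReal.ofReal (s / T) := by
  have := M.lintegral_QM_le_dual hs hT hμ (measurable_one.indicator hE)
    fun w => indicator_le_self' (fun _ _ => zero_le) w
  simpa [lintegral_indicator_one hE] using this

lemma lintegral_lintegral_P_Q_le {s T : ℝ} (hs : 0 ≤ s) (hT : 0 < T) (x : X)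
    {F : X → ENNReal} (hF : Measurable F) (hF1 : ∀ w, F w ≤ 1) :
    ∫⁻ y, ∫⁻ w, F w ∂M.P s y ∂M.Q T x ≤ ∫⁻ w, F w ∂M.Q T x + ENNReal.ofReal (s / T) := by
  have h := M.lintegral_QM_dual_le hs hT (μ := Measure.dirac x) (by simp) hF hF1
  rwa [M.lintegral_QM_dual hs hT hF, ← M.lintegral_dual_QM hs hT hF, M.lintegral_dual _ _ hF] at h

end Averages

end MarkovSemigroup

section BaireArgument

variable {X : Type*} [MetricSpace X]

/-- The `K`-Lipschitz functions with values in `[-1, 1]`, with the topology of pointwise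
convergence. -/
def lipUnitBall (X : Type*) [MetricSpace X] (K : NNReal) : Set (X → ℝ) :=
  {f | LipschitzWith K f ∧ ∀ x, f x ∈ Icc (-1 : ℝ) 1}

lemma isCompact_lipUnitBall (K : NNReal) : IsCompact (lipUnitBall X K) := by
  have h : lipUnitBall X K = univ.pi (fun _ => Icc (-1 : ℝ) 1) ∩ {f | LipschitzWith K f} := by
    ext f
    simp only [lipUnitBall, mem_ofPred_eq, mem_inter_iff, mem_univ_pi, and_comm]
  rw [h]
  exact (isCompact_univ_pi fun _ => isCompact_Icc).inter_right (isClosed_setOfPred_lipschitzWith K)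

lemma firstCountableTopology_lipUnitBall [SecondCountableTopology X] [Nonempty X] (K : NNReal) :
    FirstCountableTopology (lipUnitBall X K) := by
  have : CompactSpace (lipUnitBall X K) := isCompact_iff_compactSpace.1 (isCompact_lipUnitBall K)
  have hc : Continuous fun (f : lipUnitBall X K) (n : ℕ) => f.1 (TopologicalSpace.denseSeq X n) :=
    continuous_pi fun n => (continuous_apply _).comp continuous_subtype_val
  have hi : Function.Injective
      fun (f : lipUnitBall X K) (n : ℕ) => f.1 (TopologicalSpace.denseSeq X n) := by
    intro f g hfg
    refine Subtype.ext (f.2.1.continuous.ext_on (TopologicalSpace.denseRange_denseSeq X)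
      g.2.1.continuous ?_)
    rintro _ ⟨n, rfl⟩
    exact congrFun hfg n
  exact (hc.isClosedEmbedding hi).isEmbedding.isInducing.firstCountableTopology

lemma continuous_integral_lipUnitBall [SecondCountableTopology X] [MeasurableSpace X]
    [BorelSpace X] [Nonempty X] (K : NNReal) (μ : Measure X) [IsFiniteMeasure μ] :
    Continuous fun f : lipUnitBall X K => ∫ y, f.1 y ∂μ := by
  have := firstCountableTopology_lipUnitBall (X := X) K
  refine continuous_of_dominated (bound := fun _ => 1)
    (fun f => f.2.1.continuous.aestronglyMeasurable)
    (fun f => Eventually.of_forall fun x => ?_) (integrable_const _)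
    (Eventually.of_forall fun x => (continuous_apply x).comp continuous_subtype_val)
  rw [Real.norm_eq_abs, abs_le]
  exact f.2.2 x

lemma min_mul_infDist_le_add (K : NNReal) (S : Set X) (x y : X) :
    min 2 (K * infDist x S) ≤ min 2 (K * infDist y S) + K * dist x y := by
  rw [← min_add_add_right]
  refine min_le_min (le_add_of_nonneg_right (by positivity)) ?_
  rw [← mul_add]
  gcongr
  exact infDist_le_infDist_add_dist

/-- Under the e-property, a point has a neighbourhood on which the transition averages of
suitable cut-off functions of complements of neighbourhoods of a growing sequence of finite sets
are uniformly close. -/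
lemma MarkovSemigroup.EProperty.exists_uniform_cutoff [SecondCountableTopology X]
    [MeasurableSpace X] [BorelSpace X] {M : MarkovSemigroup X} (hE : M.EProperty) (z : X)
    {K : NNReal} {η : ℝ} (hη : 0 < η) :
    ∃ (δ : ℝ) (S : ℕ → Finset X) (g : ℕ → X → ℝ), 0 < δ ∧ (∀ n, (S n).Nonempty) ∧
      (∀ n, Continuous (g n)) ∧ Antitone g ∧ (∀ n x, g n x ∈ Icc (0 : ℝ) 1) ∧
      (∀ x, Tendsto (fun n => g n x) atTop (𝓝 0)) ∧
      (∀ n x, 2 ≤ K * infDist x (S n : Set X) → g n x = 1) ∧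
      ∀ n x, dist x z < δ → ∀ t, 0 ≤ t → |M.act t (g n) x - M.act t (g n) z| ≤ η := by
  classical
  have : Nonempty X := ⟨z⟩
  have : CompactSpace (lipUnitBall X K) := isCompact_iff_compactSpace.1 (isCompact_lipUnitBall K)
  let E : ℕ → Set (lipUnitBall X K) := fun n => ⋂ (x : X) (_ : dist x z < 1 / (n + 1 : ℝ))
    (t : ℝ) (_ : 0 ≤ t), {f | |M.act t f.1 x - M.act t f.1 z| ≤ η}
  have hEmem : ∀ n (f : lipUnitBall X K), f ∈ E n ↔ ∀ x, dist x z < 1 / (n + 1 : ℝ) →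
      ∀ t, 0 ≤ t → |M.act t f.1 x - M.act t f.1 z| ≤ η := fun n f => by simp [E]
  have hEclosed : ∀ n, IsClosed (E n) := fun n =>
    isClosed_iInter fun x => isClosed_iInter fun _ => isClosed_iInter fun t =>
      isClosed_iInter fun _ => isClosed_le ((continuous_integral_lipUnitBall K (M.P t x)).sub
        (continuous_integral_lipUnitBall K (M.P t z))).abs continuous_const
  have hEunion : ⋃ n, E n = univ := by
    refine eq_univ_of_forall fun f => mem_iUnion.2 ?_
    obtain ⟨δ, hδ, h⟩ := hE f.1 ⟨⟨K, f.2.1⟩, 1, fun x => abs_le.2 (f.2.2 x)⟩ z η hη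
    obtain ⟨n, hn⟩ := exists_nat_one_div_lt hδ
    exact ⟨n, (hEmem n f).2 fun x hx t ht => (h x (hx.trans hn) t ht).le⟩
  have : Nonempty (lipUnitBall X K) := ⟨⟨fun _ => 0, LipschitzWith.const' 0, by simp⟩⟩
  obtain ⟨m, f₀, hf₀⟩ := nonempty_interior_of_iUnion_of_closed hEclosed hEunion
  obtain ⟨U, hU, hUE⟩ := isOpen_induced_iff.1 (isOpen_interior (s := E m))
  obtain ⟨I, u, hu, huU⟩ := isOpen_pi_iff.1 hU f₀.1 (by
    change f₀ ∈ Subtype.val ⁻¹' U; rw [hUE]; exact hf₀)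
  have key : ∀ f (hf : f ∈ lipUnitBall X K), (∀ x ∈ I, f x = f₀.1 x) →
      ∀ x, dist x z < 1 / (m + 1 : ℝ) → ∀ t, 0 ≤ t → |M.act t f x - M.act t f z| ≤ η := by
    intro f hf hfI
    refine (hEmem m ⟨f, hf⟩).1 (interior_subset ?_)
    rw [← hUE]
    refine huU fun x hx => ?_
    simp only [hfI x hx]
    exact (hu x hx).2
  let y := TopologicalSpace.denseSeq X
  let S : ℕ → Finset X := fun n => I ∪ (Finset.range (n + 1)).image y
  have hyS : ∀ i n, i ≤ n → y i ∈ (S n : Set X) := fun i n hin => by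
    simp only [S, Finset.coe_union, Finset.coe_image]
    exact .inr ⟨i, by simp; omega, rfl⟩
  have hSmono : ∀ n n', n ≤ n' → (S n : Set X) ⊆ S n' := fun n n' h => by
    simp only [S]
    gcongr
  have hSne : ∀ n, (S n : Set X).Nonempty := fun n => ⟨_, hyS 0 n n.zero_le⟩
  let m₀ : ℕ → X → ℝ := fun n x => min 2 (K * infDist x (S n : Set X))
  have hm0 : ∀ n x, 0 ≤ m₀ n x := fun n x =>
    le_min zero_le_two (by positivity [infDist_nonneg (x := x) (s := (S n : Set X))])
  have hm2 : ∀ n x, m₀ n x ≤ 2 := fun n x => min_le_left _ _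
  have hmI : ∀ n, ∀ x ∈ I, m₀ n x = 0 := fun n x hx => by
    have : infDist x (S n : Set X) = 0 := infDist_zero_of_mem (by simp [S, hx])
    simp [m₀, this]
  have hmLip : ∀ n, LipschitzWith K fun x => -1 + m₀ n x := fun n =>
    LipschitzWith.of_le_add_mul K fun x y => by
      have := min_mul_infDist_le_add K (S n : Set X) x y
      simp only [m₀]
      linarith
  have hmLip' : ∀ n, LipschitzWith K fun x => 1 - m₀ n x := fun n => by
    refine LipschitzWith.of_le_add_mul K fun x y => ?_
    have := min_mul_infDist_le_add K (S n : Set X) y x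
    rw [dist_comm] at this
    simp only [m₀]
    linarith
  have hf := fun x => f₀.2.2 x
  let hi : ℕ → X → ℝ := fun n x => max (f₀.1 x) (-1 + m₀ n x)
  let lo : ℕ → X → ℝ := fun n x => min (f₀.1 x) (1 - m₀ n x)
  have hhi : ∀ n, hi n ∈ lipUnitBall X K := fun n => by
    refine ⟨by simpa using f₀.2.1.max (hmLip n), fun x =>
      ⟨(hf x).1.trans (le_max_left _ _), max_le (hf x).2 ?_⟩⟩
    linarith [hm2 n x]
  have hlo : ∀ n, lo n ∈ lipUnitBall X K := fun n => by
    refine ⟨by simpa using f₀.2.1.min (hmLip' n), fun x =>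
      ⟨le_min (hf x).1 ?_, (min_le_left _ _).trans (hf x).2⟩⟩
    linarith [hm2 n x]
  have hint : ∀ f ∈ lipUnitBall X K, ∀ t x, Integrable f (M.P t x) := fun f hf t x =>
    Integrable.of_bound hf.1.continuous.aestronglyMeasurable 1
      (Eventually.of_forall fun w => abs_le.2 (hf.2 w))
  refine ⟨1 / (m + 1 : ℝ), S, fun n x => (hi n x - lo n x) / 2, by positivity, hSne, fun n => ?_,
    fun n n' hnn x => ?_, fun n x => ⟨?_, ?_⟩, fun x => ?_, fun n x hx => ?_, fun n x hx t ht => ?_⟩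
  · exact ((hhi n).1.continuous.sub (hlo n).1.continuous).div_const 2
  · have : m₀ n' x ≤ m₀ n x := by
      simp only [m₀]
      gcongr
      exact infDist_le_infDist_of_subset (hSmono n n' hnn) (hSne n)
    simp only [hi, lo]
    gcongr
  · have h1 : lo n x ≤ f₀.1 x := min_le_left _ _
    have h2 : f₀.1 x ≤ hi n x := le_max_left _ _
    linarith
  · linarith [((hhi n).2 x).2, ((hlo n).2 x).1]
  · have hd : Tendsto (fun n => infDist x (S n : Set X)) atTop (𝓝 0) := by
      refine Metric.tendsto_atTop.2 fun ε hε => ?_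
      obtain ⟨_, ⟨i, rfl⟩, hi⟩ := Metric.mem_closure_iff.1
        (TopologicalSpace.denseRange_denseSeq X x) ε hε
      refine ⟨i, fun n hn => ?_⟩
      rw [Real.dist_eq, sub_zero, abs_of_nonneg infDist_nonneg]
      exact (infDist_le_dist_of_mem (hyS i n hn)).trans_lt hi
    have hd' := hd.const_mul (K : ℝ)
    rw [mul_zero] at hd'
    refine squeeze_zero (fun n => ?_) (fun n => ?_) hd'
    · have h1 : lo n x ≤ f₀.1 x := min_le_left _ _
      have h2 : f₀.1 x ≤ hi n x := le_max_left _ _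
      linarith
    · have h0 : m₀ n x ≤ K * infDist x (S n : Set X) := min_le_right _ _
      have h1 : f₀.1 x - m₀ n x ≤ lo n x := le_min (by linarith [hm0 n x]) (by linarith [(hf x).2])
      have h2 : hi n x ≤ f₀.1 x + m₀ n x := max_le (by linarith [hm0 n x]) (by linarith [(hf x).1])
      linarith
  · have h0 : m₀ n x = 2 := min_eq_left hx
    have h1 : hi n x = 1 := by
      simp only [hi, h0]; rw [max_eq_right] <;> linarith [(hf x).2]
    have h2 : lo n x = -1 := by
      simp only [lo, h0]; rw [min_eq_right] <;> linarith [(hf x).1]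
    simp only [h1, h2]; norm_num
  · have hact : ∀ w, M.act t (fun x => (hi n x - lo n x) / 2) w =
        (M.act t (hi n) w - M.act t (lo n) w) / 2 := fun w => by
      simp only [MarkovSemigroup.act]
      rw [integral_div, integral_sub (hint _ (hhi n) t w) (hint _ (hlo n) t w)]
    have h1 := abs_le.1 (key _ (hhi n) (fun w hw => by
      simp only [hi, hmI n w hw]; rw [max_eq_left]; linarith [(hf w).1]) x hx t ht)
    have h2 := abs_le.1 (key _ (hlo n) (fun w hw => by
      simp only [lo, hmI n w hw]; rw [min_eq_left]; linarith [(hf w).2]) x hx t ht)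
    rw [hact, hact, abs_le]
    constructor <;> linarith [h1.1, h1.2, h2.1, h2.2]

end BaireArgument

section UniformTightness

variable {X : Type*} [MetricSpace X] [MeasurableSpace X] [BorelSpace X]
  {M : MarkovSemigroup X}

lemma MarkovSemigroup.ofReal_act (t : ℝ) (x : X) {f : X → ℝ} (hf : Continuous f)
    (hf01 : ∀ w, f w ∈ Icc (0 : ℝ) 1) :
    ENNReal.ofReal (M.act t f x) = ∫⁻ w, ENNReal.ofReal (f w) ∂M.P t x :=
  ofReal_integral_eq_lintegral_ofReal
    (Integrable.of_bound hf.aestronglyMeasurable 1 (Eventually.of_forall fun w => by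
      rw [Real.norm_eq_abs, abs_of_nonneg (hf01 w).1]; exact (hf01 w).2))
    (Eventually.of_forall fun w => (hf01 w).1)

/-- A decreasing sequence of cut-offs whose transition averages are uniformly equicontinuous at a
point `z` with recurrent neighbourhoods has uniformly small transition averages at `z`. -/
lemma MarkovSemigroup.exists_forall_act_le {z : X} {δ η c T₀ : ℝ} (hη : 0 < η) (hc : 0 < c)
    (hrec : ∀ T, T₀ ≤ T → ENNReal.ofReal c ≤ M.Q T z (ball z δ))
    {g : ℕ → X → ℝ} (hg : ∀ n, Continuous (g n)) (hanti : Antitone g)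
    (hg01 : ∀ n x, g n x ∈ Icc (0 : ℝ) 1)
    (hlim : ∀ x, Tendsto (fun n => g n x) atTop (𝓝 0))
    (hequi : ∀ n x, dist x z < δ → ∀ t, 0 ≤ t → |M.act t (g n) x - M.act t (g n) z| ≤ η) :
    ∃ n, ∀ s, 0 ≤ s → M.act s (g n) z ≤ 5 * η := by
  by_contra! hcon
  choose s hs0 hs using hcon
  have hbound : ∀ n x, ‖g n x‖ ≤ 1 := fun n x => by
    rw [Real.norm_eq_abs, abs_of_nonneg (hg01 n x).1]; exact (hg01 n x).2
  have hint : ∀ n t x, Integrable (g n) (M.P t x) := fun n t x =>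
    Integrable.of_bound (hg n).aestronglyMeasurable 1 (Eventually.of_forall (hbound n))
  have hnext : ∀ n, ∃ m, n ≤ m ∧ M.act (s n) (g m) z ≤ η := fun n => by
    have h : Tendsto (fun m => M.act (s n) (g m) z) atTop (𝓝 (∫ _, (0 : ℝ) ∂M.P (s n) z)) :=
      tendsto_integral_of_dominated_convergence (fun _ => 1)
        (fun m => (hg m).aestronglyMeasurable) (integrable_const _)
        (fun m => Eventually.of_forall (hbound m)) (Eventually.of_forall hlim)
    rw [integral_zero] at h
    obtain ⟨m, h1, h2⟩ := ((eventually_ge_atTop n).and (h.eventually (ge_mem_nhds hη))).exists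
    exact ⟨m, h1, h2⟩
  choose next hle hsmall using hnext
  let N : ℕ → ℕ := fun k => next^[k] 0
  have hN : ∀ k, N (k + 1) = next (N k) := fun k => Function.iterate_succ_apply' next k 0
  let f : ℕ → X → ℝ := fun k x => g (N k) x - g (N (k + 1)) x
  have hf : ∀ k, Continuous (f k) := fun k => (hg _).sub (hg _)
  have hf01 : ∀ k x, f k x ∈ Icc (0 : ℝ) 1 := fun k x => by
    have h1 : g (N (k + 1)) x ≤ g (N k) x := hanti (by rw [hN]; exact hle _) x
    exact ⟨sub_nonneg.2 h1, by linarith [(hg01 (N k) x).2, (hg01 (N (k + 1)) x).1]⟩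
  have hflow : ∀ k x, x ∈ ball z δ → 2 * η ≤ M.act (s (N k)) (f k) x := fun k x hx => by
    have e : M.act (s (N k)) (f k) x
        = M.act (s (N k)) (g (N k)) x - M.act (s (N k)) (g (N (k + 1))) x :=
      integral_sub (hint _ _ _) (hint _ _ _)
    have h1 := abs_le.1 (hequi (N k) x hx _ (hs0 (N k)))
    have h2 := abs_le.1 (hequi (N (k + 1)) x hx _ (hs0 (N k)))
    have h3 := hs (N k)
    have h4 := hsmall (N k)
    rw [← hN] at h4
    rw [e]
    linarith [h1.1, h2.2]
  obtain ⟨J, hJ⟩ := exists_nat_gt (1 / (η * c))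
  let tot := ∑ k ∈ Finset.range J, s (N k)
  obtain ⟨T, hT0, hTs, hT1⟩ : ∃ T, T₀ ≤ T ∧ tot ≤ T ∧ 1 ≤ T :=
    ⟨max T₀ (max tot 1), le_max_left _ _, (le_max_left _ _).trans (le_max_right _ _),
      (le_max_right _ _).trans (le_max_right _ _)⟩
  have hT : 0 < T := by linarith
  have := M.isProbabilityMeasure_Q hT z
  have hterm : ∀ k, ENNReal.ofReal (2 * η * c) ≤
      ∫⁻ w, ENNReal.ofReal (f k w) ∂M.Q T z + ENNReal.ofReal (s (N k) / T) := fun k => by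
    refine le_trans ?_ (M.lintegral_lintegral_P_Q_le (hs0 (N k)) hT z
      (hf k).measurable.ennreal_ofReal (fun w => by simpa using (hf01 k w).2))
    calc ENNReal.ofReal (2 * η * c) = ENNReal.ofReal (2 * η) * ENNReal.ofReal c :=
          ENNReal.ofReal_mul (by positivity)
      _ ≤ ENNReal.ofReal (2 * η) * M.Q T z (ball z δ) := by gcongr; exact hrec T hT0
      _ = ∫⁻ _ in ball z δ, ENNReal.ofReal (2 * η) ∂M.Q T z := by rw [setLIntegral_const]
      _ ≤ ∫⁻ y in ball z δ, ∫⁻ w, ENNReal.ofReal (f k w) ∂M.P (s (N k)) y ∂M.Q T z :=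
          setLIntegral_mono' measurableSet_ball fun y hy => by
            rw [← ofReal_act _ _ (hf k) (hf01 k)]
            exact ENNReal.ofReal_le_ofReal (hflow k y hy)
      _ ≤ _ := setLIntegral_le_lintegral _ _
  have hsum : ∑ k ∈ Finset.range J, ∫⁻ w, ENNReal.ofReal (f k w) ∂M.Q T z ≤ 1 := by
    rw [← lintegral_finsetSum _ fun k _ => (hf k).measurable.ennreal_ofReal]
    calc _ ≤ ∫⁻ _, 1 ∂M.Q T z := lintegral_mono fun w => by
          rw [← ENNReal.ofReal_sum_of_nonneg fun k _ => (hf01 k w).1]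
          simp only [f]
          rw [Finset.sum_range_sub' (fun k => g (N k) w)]
          rw [ENNReal.ofReal_le_one]
          linarith [(hg01 (N 0) w).2, (hg01 (N J) w).1]
      _ = 1 := by simp
  have hsum' : ∑ k ∈ Finset.range J, ENNReal.ofReal (s (N k) / T) ≤ 1 := by
    rw [← ENNReal.ofReal_sum_of_nonneg fun k _ => div_nonneg (hs0 _) hT.le, ← Finset.sum_div]
    simpa using (div_le_one hT).2 hTs
  have htot : ∑ k ∈ Finset.range J, ENNReal.ofReal (2 * η * c) ≤ 1 + 1 :=
    (Finset.sum_le_sum fun k _ => hterm k).trans (by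
      rw [Finset.sum_add_distrib]; exact add_le_add hsum hsum')
  rw [← ENNReal.ofReal_sum_of_nonneg fun k _ => by positivity, Finset.sum_const,
    Finset.card_range, nsmul_eq_mul, one_add_one_eq_two, ← ENNReal.ofReal_ofNat,
    ENNReal.ofReal_le_ofReal_iff (by norm_num)] at htot
  rw [div_lt_iff₀ (by positivity)] at hJ
  linarith

lemma MarkovSemigroup.EProperty.exists_finset_forall_le [SecondCountableTopology X]
    (hE : M.EProperty) {z : X}
    (hrec : ∀ δ, 0 < δ → ∃ c T₀ : ℝ, 0 < c ∧
      ∀ T, T₀ ≤ T → ENNReal.ofReal c ≤ M.Q T z (ball z δ))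
    {r η : ℝ} (hr : 0 < r) (hη : 0 < η) :
    ∃ (S : Finset X) (δ : ℝ), S.Nonempty ∧ 0 < δ ∧ ∀ x ∈ ball z δ, ∀ s, 0 ≤ s →
      M.P s x {y | r ≤ infDist y (S : Set X)} ≤ ENNReal.ofReal η := by
  have hη' : 0 < η / 6 := by positivity
  obtain ⟨δ, S, g, hδ, hS, hg, hanti, hg01, hlim, hone, hequi⟩ :=
    hE.exists_uniform_cutoff z (K := (2 / r).toNNReal) hη'
  obtain ⟨c, T₀, hc, hT₀⟩ := hrec δ hδ
  obtain ⟨n, hn⟩ := exists_forall_act_le hη' hc hT₀ hg hanti hg01 hlim hequi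
  refine ⟨S n, δ, hS n, hδ, fun x hx s hs => ?_⟩
  have hW : MeasurableSet {y | r ≤ infDist y (S n : Set X)} :=
    measurableSet_le measurable_const measurable_infDist
  calc M.P s x {y | r ≤ infDist y (S n : Set X)}
      = ∫⁻ w, {y | r ≤ infDist y (S n : Set X)}.indicator 1 w ∂M.P s x :=
        (lintegral_indicator_one hW).symm
    _ ≤ ∫⁻ w, ENNReal.ofReal (g n w) ∂M.P s x := lintegral_mono fun w => by
        refine indicator_apply_le' (fun hy => ?_) (fun _ => zero_le)
        rw [hone n w]
        · simp
        · rw [Real.coe_toNNReal _ (by positivity)]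
          calc 2 = 2 / r * r := by field_simp
            _ ≤ _ := by gcongr; exact hy
    _ = ENNReal.ofReal (M.act s (g n) x) := (ofReal_act _ _ (hg n) (hg01 n)).symm
    _ ≤ ENNReal.ofReal η := by
        refine ENNReal.ofReal_le_ofReal ?_
        linarith [(abs_le.1 (hequi n x hx s hs)).2, hn s hs]

end UniformTightness

section Recurrence

variable {X : Type*} [MeasurableSpace X] (M : MarkovSemigroup X)

instance MarkovSemigroup.isFiniteMeasure_dual (t : ℝ) (μ : Measure X) [IsFiniteMeasure μ] :
    IsFiniteMeasure (M.dual t μ) :=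
  ⟨by rw [M.dual_univ]; exact measure_lt_top _ _⟩

lemma MarkovSemigroup.Q_apply_le_mul {a T T₀ : ℝ} (ha : 0 < a) (haT : a ≤ T) (hTT₀ : T ≤ T₀)
    (x : X) {E : Set X} (hE : MeasurableSet E) :
    M.Q T x E ≤ ENNReal.ofReal (T₀ / a) * M.Q T₀ x E := by
  have hT : 0 < T := by linarith
  have hT₀ : 0 < T₀ := by linarith
  rw [M.Q_apply hT x hE, M.Q_apply hT₀ x hE, lintegral_timeAvg, lintegral_timeAvg, ← mul_assoc,
    ← ENNReal.ofReal_mul (by positivity), show T₀ / a * (1 / T₀) = 1 / a by field_simp]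
  gcongr

lemma MarkovSemigroup.Q_apply_le_of_forall_le {T : ℝ} (hT : 0 < T) {x : X} {E : Set X}
    (hE : MeasurableSet E) {A : ENNReal} (h : ∀ s ∈ Ioc 0 T, M.P s x E ≤ A) :
    M.Q T x E ≤ A := by
  have := isProbabilityMeasure_timeAvg hT
  rw [M.Q_apply hT x hE]
  calc ∫⁻ s, M.P s x E ∂timeAvg T ≤ ∫⁻ _, A ∂timeAvg T :=
        lintegral_mono_ae ((ae_timeAvg_pos T).mono h)
    _ = A := by simp

lemma MarkovSemigroup.exists_le_dual_of_eventually_le {D B : Set X} (hD : MeasurableSet D)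
    (hB : MeasurableSet B) {q q' : ℝ} (hq : 0 ≤ q) (hqq' : q < q')
    (h : ∀ y ∈ D, ∀ᶠ T in atTop, ENNReal.ofReal q' ≤ M.Q T y B) (ν : Measure X)
    [IsFiniteMeasure ν] : ∃ s, 0 ≤ s ∧ ENNReal.ofReal q * ν D ≤ M.dual s ν B := by
  by_cases h0 : ν D = 0
  · exact ⟨0, le_rfl, by simp [h0]⟩
  have hpos : ∀ n : ℕ, (0 : ℝ) < n + 1 := fun n => by positivity
  have hmeas : ∀ n : ℕ, Measurable fun y => M.Q (n + 1) y B := fun n => by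
    simpa [lintegral_indicator_one hB] using
      M.measurable_lintegral_Q (hpos n) (measurable_one.indicator hB)
  have hlt : ENNReal.ofReal q * ν D <
      liminf (fun n : ℕ => ∫⁻ y in D, M.Q (n + 1) y B ∂ν) atTop :=
    calc ENNReal.ofReal q * ν D < ENNReal.ofReal q' * ν D :=
          ENNReal.mul_lt_mul_left h0 (measure_ne_top _ _)
            ((ENNReal.ofReal_lt_ofReal_iff (hq.trans_lt hqq')).2 hqq')
      _ = ∫⁻ _ in D, ENNReal.ofReal q' ∂ν := by rw [setLIntegral_const]
      _ ≤ ∫⁻ y in D, liminf (fun n : ℕ => M.Q (n + 1) y B) atTop ∂ν :=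
          setLIntegral_mono' hD fun y hy => le_liminf_of_le (by isBoundedDefault)
            ((tendsto_natCast_atTop_atTop.atTop_add tendsto_const_nhds).eventually (h y hy))
      _ ≤ _ := lintegral_liminf_le hmeas
  obtain ⟨n, hn⟩ := (eventually_lt_of_lt_liminf hlt).exists
  obtain ⟨s, hs, h⟩ := M.exists_QM_le_dual (hpos n) ν hB
  refine ⟨s, hs, hn.le.trans (le_trans ?_ h)⟩
  rw [M.QM_apply_eq_lintegral_Q (hpos n) ν hB]
  exact setLIntegral_le_lintegral _ _

/-- Let `B` be a set from which the mass transported to `W` is at most `A`, and `D` a set from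
which a proportion `q` of any mass can be transported to `B`. If the averages started at `x` charge
`Dᶜ` by at most `ε`, all but `2ε` of the mass started at `x` can successively be absorbed in `B`:
`a` is the absorbed mass and `ν` is the measure that remains. -/
lemma MarkovSemigroup.exists_remainder {x : X} {W B D : Set X} (hW : MeasurableSet W)
    (hB : MeasurableSet B) (hD : MeasurableSet D) {A : ENNReal}
    (hA : ∀ y ∈ B, ∀ s, 0 ≤ s → M.P s y W ≤ A) {ε q : ℝ} (hε : 0 < ε)
    (hDx : ∀ᶠ T in atTop, M.Q T x Dᶜ ≤ ENNReal.ofReal ε) (hq0 : 0 < q) (hq1 : q ≤ 1)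
    (hq : ∀ ν : Measure X, IsFiniteMeasure ν →
      ∃ s, 0 ≤ s ∧ ENNReal.ofReal q * ν D ≤ M.dual s ν B) (k : ℕ) :
    ∃ (ν : Measure X) (a : ENNReal) (C : ℝ), a + ν univ = 1 ∧ 0 ≤ C ∧
      (∀ T, 0 < T → M.Q T x W ≤ A * a + M.QM T ν W + ENNReal.ofReal (C / T)) ∧
      (∀ T, 0 < T → M.QM T ν Dᶜ ≤ M.Q T x Dᶜ + ENNReal.ofReal (C / T)) ∧
      ν.real univ ≤ 2 * ε + (1 - q) ^ k := by
  induction k with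
  | zero =>
    exact ⟨Measure.dirac x, 0, 0, by simp, le_rfl, fun T _ => by simp [Q], fun T _ => by simp [Q],
      by simp; positivity⟩
  | succ k ih =>
    obtain ⟨ν, a, C, hmass, hC, hWν, hDν, hk⟩ := ih
    have hν1 : ν univ ≤ 1 := hmass ▸ le_add_self
    have : IsFiniteMeasure ν := ⟨hν1.trans_lt ENNReal.one_lt_top⟩
    obtain ⟨T, hTD, hTC, hT1⟩ :=
      (hDx.and ((eventually_ge_atTop (C / ε)).and (eventually_ge_atTop 1))).exists
    have hT : 0 < T := by linarith
    obtain ⟨s, hs, hsD⟩ := M.exists_dual_le_QM hT ν hD.compl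
    have hsD' : M.dual s ν Dᶜ ≤ ENNReal.ofReal (2 * ε) := by
      rw [two_mul, ENNReal.ofReal_add hε.le hε.le]
      refine hsD.trans ((hDν T hT).trans (add_le_add hTD (ENNReal.ofReal_le_ofReal ?_)))
      rw [div_le_iff₀ hε] at hTC
      rw [div_le_iff₀ hT]
      linarith
    obtain ⟨t, ht, htB⟩ := hq (M.dual s ν) inferInstance
    rw [M.dual_dual ht hs] at htB
    have hst : 0 ≤ s + t := add_nonneg hs ht
    set ν' := M.dual (s + t) ν with hν'
    have hsplit : ν'.restrict B + ν'.restrict Bᶜ = ν' := Measure.restrict_add_restrict_compl hB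
    have hC' : ∀ T, 0 < T → ENNReal.ofReal ((C + (s + t)) / T) =
        ENNReal.ofReal (C / T) + ENNReal.ofReal ((s + t) / T) := fun T hT => by
      rw [add_div, ENNReal.ofReal_add (by positivity) (by positivity)]
    refine ⟨ν'.restrict Bᶜ, a + ν' B, C + (s + t), ?_, by positivity, fun T hT => ?_,
      fun T hT => ?_, ?_⟩
    · rw [Measure.restrict_apply_univ, add_assoc, measure_add_measure_compl hB, hν', M.dual_univ,
        hmass]
    · have h1 : M.QM T (ν'.restrict B) W ≤ A * ν' B := by
        rw [M.QM_apply_eq_lintegral_Q hT _ hW, ← setLIntegral_const]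
        exact setLIntegral_mono' hB fun y hy =>
          M.Q_apply_le_of_forall_le hT hW fun r hr => hA y hy r hr.1.le
      have h2 : M.QM T ν' W = M.QM T (ν'.restrict B) W + M.QM T (ν'.restrict Bᶜ) W := by
        rw [M.QM_apply_eq_lintegral_Q hT _ hW, M.QM_apply_eq_lintegral_Q hT _ hW,
          M.QM_apply_eq_lintegral_Q hT _ hW, ← lintegral_add_measure, hsplit]
      calc M.Q T x W ≤ A * a + M.QM T ν W + ENNReal.ofReal (C / T) := hWν T hT
        _ ≤ A * a + (A * ν' B + M.QM T (ν'.restrict Bᶜ) W + ENNReal.ofReal ((s + t) / T)) +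
            ENNReal.ofReal (C / T) := by
          gcongr
          refine (M.QM_apply_le_dual hst hT hν1 hW).trans ?_
          rw [← hν', h2]
          gcongr
        _ = _ := by rw [hC' T hT]; ring
    · calc M.QM T (ν'.restrict Bᶜ) Dᶜ ≤ M.QM T ν' Dᶜ := by
            rw [M.QM_apply_eq_lintegral_Q hT _ hD.compl, M.QM_apply_eq_lintegral_Q hT _ hD.compl]
            exact setLIntegral_le_lintegral _ _
        _ ≤ M.QM T ν Dᶜ + ENNReal.ofReal ((s + t) / T) := M.QM_dual_apply_le hst hT hν1 hD.compl
        _ ≤ _ := by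
          rw [hC' T hT, ← add_assoc]
          gcongr
          exact hDν T hT
    · have e1 : ν'.real B + ν'.real Bᶜ = ν.real univ := by
        rw [measureReal_add_measureReal_compl hB, measureReal_def, hν', M.dual_univ,
          measureReal_def]
      have e2 : (M.dual s ν).real D + (M.dual s ν).real Dᶜ = ν.real univ := by
        rw [measureReal_add_measureReal_compl hD, measureReal_def, M.dual_univ, measureReal_def]
      have e3 : (M.dual s ν).real Dᶜ ≤ 2 * ε := ENNReal.toReal_le_of_le_ofReal (by positivity) hsD'
      have e4 : q * (M.dual s ν).real D ≤ ν'.real B := by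
        have := ENNReal.toReal_mono (measure_ne_top _ _) htB
        rwa [ENNReal.toReal_mul, ENNReal.toReal_ofReal hq0.le] at this
      have e5 : (ν'.restrict Bᶜ).real univ = ν'.real Bᶜ := by simp [measureReal_def]
      rw [e5, pow_succ]
      have e6 := mul_le_mul_of_nonneg_left hk (sub_nonneg.2 hq1)
      nlinarith

lemma MarkovSemigroup.eventually_Q_apply_le {x : X} {W B D : Set X} (hW : MeasurableSet W)
    (hB : MeasurableSet B) (hD : MeasurableSet D) {A : ENNReal}
    (hA : ∀ y ∈ B, ∀ s, 0 ≤ s → M.P s y W ≤ A) {ε q : ℝ} (hε : 0 < ε)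
    (hDx : ∀ᶠ T in atTop, M.Q T x Dᶜ ≤ ENNReal.ofReal ε) (hq0 : 0 < q) (hq1 : q ≤ 1)
    (hq : ∀ ν : Measure X, IsFiniteMeasure ν →
      ∃ s, 0 ≤ s ∧ ENNReal.ofReal q * ν D ≤ M.dual s ν B) :
    ∀ᶠ T in atTop, M.Q T x W ≤ A + ENNReal.ofReal (4 * ε) := by
  obtain ⟨k, hk⟩ := exists_pow_lt_of_lt_one hε (show 1 - q < 1 by linarith)
  obtain ⟨ν, a, C, hmass, hC, hWν, -, hνk⟩ :=
    M.exists_remainder hW hB hD hA hε hDx hq0 hq1 hq k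
  have hν1 : ν univ ≤ 1 := hmass ▸ le_add_self
  have : IsFiniteMeasure ν := ⟨hν1.trans_lt ENNReal.one_lt_top⟩
  filter_upwards [eventually_ge_atTop (C / ε), eventually_gt_atTop 0] with T hTC hT
  have e : ENNReal.ofReal (4 * ε) = ENNReal.ofReal (3 * ε) + ENNReal.ofReal ε := by
    rw [← ENNReal.ofReal_add (by positivity) hε.le]; ring_nf
  rw [e, ← add_assoc]
  refine (hWν T hT).trans ?_
  gcongr
  · exact mul_le_of_le_one_right' (hmass ▸ le_self_add)
  · calc M.QM T ν W = ∫⁻ y, M.Q T y W ∂ν := M.QM_apply_eq_lintegral_Q hT ν hW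
      _ ≤ ∫⁻ _, 1 ∂ν := lintegral_mono fun y => by
          have := M.isProbabilityMeasure_Q hT y
          exact prob_le_one
      _ = ENNReal.ofReal (ν.real univ) := by simp
      _ ≤ _ := ENNReal.ofReal_le_ofReal (by linarith)
  · rw [div_le_iff₀ hε] at hTC
    rw [div_le_iff₀ hT]
    linarith

end Recurrence

section Tightness

variable {X : Type*} [MetricSpace X] [MeasurableSpace X] [BorelSpace X] (M : MarkovSemigroup X)

lemma MarkovSemigroup.exists_forall_Q_apply_le_of_lt (hSC : M.StochasticallyContinuous) (x : X)
    {r η : ℝ} (hr : 0 < r) (hη : 0 < η) :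
    ∃ a, 0 < a ∧ ∀ T, 0 < T → T < a → M.Q T x {y | r ≤ dist y x} ≤ ENNReal.ofReal η := by
  have hf : Continuous fun y => min 1 (dist y x / r) := by fun_prop
  have hf01 : ∀ y, min 1 (dist y x / r) ∈ Icc (0 : ℝ) 1 := fun y =>
    ⟨by positivity, min_le_left _ _⟩
  have h := hSC _ ⟨hf, 1, fun y => by rw [abs_of_nonneg (hf01 y).1]; exact (hf01 y).2⟩ x
  simp only [dist_self, zero_div, min_eq_right zero_le_one] at h
  obtain ⟨a, ha, hsub⟩ := mem_nhdsGT_iff_exists_Ioo_subset.1 (h.eventually (gt_mem_nhds hη))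
  have hE : MeasurableSet {y | r ≤ dist y x} :=
    measurableSet_le measurable_const (continuous_id.dist continuous_const).measurable
  refine ⟨a, ha, fun T hT hTa => M.Q_apply_le_of_forall_le hT hE fun s hs => ?_⟩
  calc M.P s x {y | r ≤ dist y x} = ∫⁻ w, {y | r ≤ dist y x}.indicator 1 w ∂M.P s x :=
        (lintegral_indicator_one hE).symm
    _ ≤ ∫⁻ w, ENNReal.ofReal (min 1 (dist w x / r)) ∂M.P s x := lintegral_mono fun w => by
        refine indicator_apply_le' (fun hy => ?_) (fun _ => zero_le)
        rw [min_eq_left ((one_le_div hr).2 hy)]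
        simp
    _ = _ := (M.ofReal_act s x hf hf01).symm
    _ ≤ _ := ENNReal.ofReal_le_ofReal (le_of_lt (hsub ⟨hs.1, hs.2.trans_lt hTa⟩))

lemma MarkovSemigroup.exists_finset_forall_Q_le [CompleteSpace X] [SecondCountableTopology X]
    (hSC : M.StochasticallyContinuous) (x : X) {r η : ℝ} (hr : 0 < r) (hη : 0 < η)
    (hlarge : ∃ S : Finset X, S.Nonempty ∧
      ∀ᶠ T in atTop, M.Q T x {y | r ≤ infDist y (S : Set X)} ≤ ENNReal.ofReal η) :
    ∃ S : Finset X, S.Nonempty ∧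
      ∀ T, 0 < T → M.Q T x {y | r ≤ infDist y (S : Set X)} ≤ ENNReal.ofReal η := by
  classical
  obtain ⟨S, hS, hlarge⟩ := hlarge
  obtain ⟨T₁, hT₁⟩ := eventually_atTop.1 hlarge
  obtain ⟨a, ha, hsmall⟩ := M.exists_forall_Q_apply_le_of_lt hSC x hr hη
  obtain ⟨T₀, hT₀1, hT₀a⟩ : ∃ T₀, T₁ ≤ T₀ ∧ a ≤ T₀ := ⟨max T₁ a, le_max_left _ _, le_max_right _ _⟩
  have hT₀ : 0 < T₀ := by linarith
  have := M.isProbabilityMeasure_Q hT₀ x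
  obtain ⟨K, hK, hKle⟩ := isTightMeasureSet_iff_exists_isCompact_measure_compl_le.1
    (isTightMeasureSet_singleton (μ := M.Q T₀ x)) (ENNReal.ofReal (η * (a / T₀)))
    (ENNReal.ofReal_pos.2 (by positivity))
  obtain ⟨t, -, htfin, htK⟩ := hK.finite_cover_balls hr
  let S' : Finset X := S ∪ {x} ∪ htfin.toFinset
  have hW : ∀ s : Set X, MeasurableSet {y | r ≤ infDist y s} := fun s =>
    measurableSet_le measurable_const measurable_infDist
  refine ⟨S', ⟨x, by simp [S']⟩, fun T hT => ?_⟩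
  rcases lt_or_ge T a with hTa | hTa
  · refine (measure_mono fun y hy => ?_).trans (hsmall T hT hTa)
    exact le_trans hy (infDist_le_dist_of_mem (by simp [S']))
  rcases le_or_gt T T₀ with hTT₀ | hTT₀
  · refine (M.Q_apply_le_mul ha hTa hTT₀ x (hW _)).trans ?_
    have hsub : {y | r ≤ infDist y (S' : Set X)} ⊆ Kᶜ := fun y hy hyK => by
      obtain ⟨w, hw, hyw⟩ := mem_iUnion₂.1 (htK hyK)
      exact absurd ((infDist_le_dist_of_mem (by simp [S', hw])).trans_lt hyw) (not_lt.2 hy)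
    calc _ ≤ ENNReal.ofReal (T₀ / a) * ENNReal.ofReal (η * (a / T₀)) := by
          gcongr
          exact (measure_mono hsub).trans (hKle _ rfl)
      _ = ENNReal.ofReal η := by
          rw [← ENNReal.ofReal_mul (by positivity)]
          congr 1
          field_simp
  · refine (measure_mono fun y hy => ?_).trans (hT₁ T (hT₀1.trans hTT₀.le))
    refine le_trans hy (infDist_le_infDist_of_subset ?_ (by exact_mod_cast hS))
    simp only [S', Finset.coe_union]
    exact subset_union_left.trans subset_union_left

lemma MarkovSemigroup.tightAt_of_forall_exists_finset [CompleteSpace X] {x : X}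
    (h : ∀ r η : ℝ, 0 < r → 0 < η → ∃ S : Finset X, S.Nonempty ∧
      ∀ T, 0 < T → M.Q T x {y | r ≤ infDist y (S : Set X)} ≤ ENNReal.ofReal η) :
    M.TightAt x := by
  intro ε hε
  obtain ⟨η, hη, c, hηc, hcε⟩ := NNReal.exists_pos_sum_of_countable (ε := ε.toNNReal)
    (by simpa using hε) ℕ
  have hr : ∀ n : ℕ, (0 : ℝ) < 1 / (n + 1) := fun n => by positivity
  choose S hS hQS using fun n : ℕ => h (1 / (n + 1)) (η n) (hr n) (hη n)
  let K : Set X := ⋂ n : ℕ, {y | infDist y (S n : Set X) ≤ 1 / ((n : ℝ) + 1)}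
  have hKclosed : IsClosed K :=
    isClosed_iInter fun n => isClosed_le (continuous_infDist_pt _) continuous_const
  have hKtb : TotallyBounded K := by
    refine Metric.totallyBounded_iff.2 fun ρ hρ => ?_
    obtain ⟨n, hn⟩ := exists_nat_one_div_lt hρ
    refine ⟨S n, (S n).finite_toSet, fun y hy => ?_⟩
    obtain ⟨w, hw, hyw⟩ := (infDist_lt_iff (by exact_mod_cast hS n)).1
      ((mem_iInter.1 hy n).trans_lt hn)
    exact mem_iUnion₂.2 ⟨w, hw, hyw⟩
  refine ⟨K, hKtb.isCompact_of_isClosed hKclosed, fun T hT => ?_⟩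
  have := M.isProbabilityMeasure_Q hT x
  have hcompl : M.Q T x Kᶜ ≤ ENNReal.ofReal ε :=
    calc M.Q T x Kᶜ ≤ M.Q T x (⋃ n : ℕ, {y | 1 / ((n : ℝ) + 1) ≤ infDist y (S n : Set X)}) := by
          refine measure_mono fun y hy => ?_
          simp only [K, compl_iInter, mem_iUnion] at hy ⊢
          obtain ⟨n, hn⟩ := hy
          exact ⟨n, (show 1 / ((n : ℝ) + 1) ≤ infDist y (S n : Set X) from
            le_of_not_ge fun h => hn h)⟩
      _ ≤ ∑' n : ℕ, M.Q T x {y | 1 / ((n : ℝ) + 1) ≤ infDist y (S n : Set X)} := measure_iUnion_le _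
      _ ≤ ∑' n, (η n : ENNReal) := ENNReal.tsum_le_tsum fun n => by
          simpa using hQS n T hT
      _ = c := ENNReal.tsum_coe_eq hηc
      _ ≤ ENNReal.ofReal ε := ENNReal.coe_le_coe.2 hcε.le
  have h1 : (M.Q T x).real Kᶜ ≤ ε := ENNReal.toReal_le_of_le_ofReal hε.le hcompl
  rw [probReal_compl_eq_one_sub hKclosed.measurableSet, measureReal_def] at h1
  linarith

end Tightness

/-- first part of the proof of Theorem 2. Under the e-property, a
lower bound for ergodic averages of balls around `z` uniform over bounded sets, and
uniform concentration on bounded sets, every point of the space has tight ergodic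
averages, i.e. `𝒯 = 𝒳`. -/
theorem tight_everywhere_of_uniform_lower_bound
    {X : Type*} [MetricSpace X] [CompleteSpace X] [SecondCountableTopology X]
    [MeasurableSpace X] [BorelSpace X]
    (M : MarkovSemigroup X)
    (hFeller : M.Feller) (hSC : M.StochasticallyContinuous) (hE : M.EProperty)
    (z : X)
    (hlow : ∀ A : Set X, Bornology.IsBounded A → ∀ δ : ℝ, 0 < δ →
      ∃ c : ℝ, 0 < c ∧ ∀ x ∈ A,
        c ≤ Filter.liminf (fun T : ℝ => ((M.Q T x) (Metric.ball z δ)).toReal)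
          Filter.atTop)
    (hconc : ∀ ε : ℝ, 0 < ε → ∀ x : X, ∃ D : Set X,
      Bornology.IsBounded D ∧ MeasurableSet D ∧
      1 - ε < Filter.liminf (fun T : ℝ => ((M.Q T x) D).toReal) Filter.atTop) :
    ∀ x : X, M.TightAt x := by
  have hrec : ∀ (A : Set X), Bornology.IsBounded A → ∀ δ : ℝ, 0 < δ → ∃ q : ℝ, 0 < q ∧ q ≤ 1 ∧
      ∀ y ∈ A, ∀ᶠ T in atTop, ENNReal.ofReal q ≤ M.Q T y (ball z δ) := fun A hA δ hδ => by
    obtain ⟨c, hc, h⟩ := hlow A hA δ hδ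
    refine ⟨min (c / 2) 1, by positivity, min_le_right _ _, fun y hy => ?_⟩
    have hlt : min (c / 2) 1 < liminf (fun T : ℝ => (M.Q T y (ball z δ)).toReal) atTop :=
      (min_le_left _ _).trans_lt ((half_lt_self hc).trans_le (h y hy))
    refine (eventually_lt_of_lt_liminf hlt ?_).mono fun T hT => ENNReal.ofReal_le_of_le_toReal hT.le
    exact isBoundedUnder_of ⟨0, fun _ => ENNReal.toReal_nonneg⟩
  have htail : ∀ (x : X) (r η : ℝ), 0 < r → 0 < η → ∃ S : Finset X, S.Nonempty ∧
      ∀ᶠ T in atTop, M.Q T x {y | r ≤ infDist y (S : Set X)} ≤ ENNReal.ofReal η := by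
    intro x r η hr hη
    obtain ⟨S, δ, hS, hδ, hSδ⟩ := hE.exists_finset_forall_le (z := z) (fun δ hδ => by
      obtain ⟨q, hq, -, h⟩ := hrec {z} Bornology.isBounded_singleton δ hδ
      obtain ⟨T₀, hT₀⟩ := eventually_atTop.1 (h z rfl)
      exact ⟨q, T₀, hq, hT₀⟩) hr (half_pos hη)
    have hε : 0 < η / 8 := by positivity
    obtain ⟨D, hDb, hDm, hD⟩ := hconc (η / 8) hε x
    obtain ⟨q, hq0, hq1, hq⟩ := hrec D hDb δ hδ
    have hDx : ∀ᶠ T in atTop, M.Q T x Dᶜ ≤ ENNReal.ofReal (η / 8) := by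
      filter_upwards [eventually_lt_of_lt_liminf hD
        (isBoundedUnder_of ⟨0, fun _ => ENNReal.toReal_nonneg⟩), eventually_gt_atTop 0] with T h hT
      have := M.isProbabilityMeasure_Q hT x
      rw [← ofReal_measureReal, probReal_compl_eq_one_sub hDm]
      refine ENNReal.ofReal_le_ofReal ?_
      rw [measureReal_def]
      linarith
    refine ⟨S, hS, (M.eventually_Q_apply_le
      (measurableSet_le measurable_const measurable_infDist) measurableSet_ball hDm hSδ hε hDx
      (half_pos hq0) (by linarith) fun ν _ => M.exists_le_dual_of_eventually_le hDm
        measurableSet_ball (half_pos hq0).le (half_lt_self hq0) hq ν).mono fun T hT => ?_⟩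
    refine hT.trans_eq ?_
    rw [← ENNReal.ofReal_add (by positivity) (by positivity)]
    ring_nf
  exact fun x => M.tightAt_of_forall_exists_finset fun r η hr hη =>
    M.exists_finset_forall_Q_le hSC x hr hη (htail x r η hr hη)
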